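/- Let f : [0,1] → ℝ be a Lipschitz continuous function and let a < b be real numbers. Then ∫_{f⁻¹((a,b))} f'(t) dt ∈ [a−b, b−a], where f' denotes the almost-everywhere existing derivative of f and the integral is taken over the measurable set f⁻¹((a,b)) ⊂ [0,1]. -/

import Mathlib

open MeasureTheory Filter Topology Set
open scoped ENNReal NNReal Classical

noncomputable section

/-- The derivative of the truncation of `f` to `[a, b]` is the derivative of `f` where
`f` takes values in `(a, b)`, and vanishes elsewhere. -/
lemma deriv_max_min_const {f : ℝ → ℝ} {a b t : ℝ} (hab : a < b) (hf : ContinuousAt f t) :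
    deriv (fun x ↦ max a (min b (f x))) t = (f ⁻¹' Ioo a b).indicator (deriv f) t := by
  by_cases ht : f t ∈ Ioo a b
  · rw [indicator_of_mem (mem_preimage.2 ht)]
    apply EventuallyEq.deriv_eq
    filter_upwards [hf.eventually_mem (isOpen_Ioo.mem_nhds ht)] with x hx
    rw [min_eq_right hx.2.le, max_eq_right hx.1.le]
  · rw [indicator_of_notMem (mt mem_preimage.1 ht)]
    rcases le_or_gt (f t) a with h | h
    · refine IsLocalMin.deriv_eq_zero (Eventually.of_forall fun x ↦ ?_)
      beta_reduce
      rw [max_eq_left (min_le_of_right_le h)]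
      exact le_max_left _ _
    · have hb : b ≤ f t := not_lt.1 fun hlt ↦ ht ⟨h, hlt⟩
      refine IsLocalMax.deriv_eq_zero (Eventually.of_forall fun x ↦ ?_)
      beta_reduce
      rw [min_eq_left hb, max_eq_right hab.le]
      exact max_le hab.le (min_le_left _ _)

/-- For a Lipschitz function `f : [0,1] → ℝ` and reals `a < b`, the integral
of `f'` over `f⁻¹((a,b))` lies in `[a - b, b - a]`. -/
theorem integral_deriv_over_preimage_mem_Icc (f : ℝ → ℝ) (K : ℝ≥0)
    (hf : LipschitzOnWith K f (Set.Icc 0 1)) (a b : ℝ) (hab : a < b) :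
    ∫ t in {t : ℝ | t ∈ Set.Icc (0 : ℝ) 1 ∧ f t ∈ Set.Ioo a b}, deriv f t ∈
      Set.Icc (a - b) (b - a) := by
  set g : ℝ → ℝ := fun x ↦ max a (min b (f x))
  have hg_lip : LipschitzOnWith K g (uIcc 0 1) := by
    rw [uIcc_of_le zero_le_one]
    exact LipschitzOnWith.of_dist_le_mul fun x hx y hy ↦
      (((LipschitzWith.id.const_min b).const_max a).dist_le_mul (f x) (f y)).trans
        (by simpa using hf.dist_le_mul x hx y hy)
  have hg_int : ∫ t in Ioo (0 : ℝ) 1, deriv g t = g 1 - g 0 := by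
    rw [← integral_Ioc_eq_integral_Ioo, ← intervalIntegral.integral_of_le zero_le_one]
    exact hg_lip.absolutelyContinuousOnInterval.integral_deriv_eq_sub
  have hf_cont : ContinuousOn f (Ioo 0 1) := hf.continuousOn.mono Ioo_subset_Icc_self
  have hS : MeasurableSet (Ioo 0 1 ∩ f ⁻¹' Ioo a b) :=
    (hf_cont.isOpen_inter_preimage isOpen_Ioo isOpen_Ioo).measurableSet
  have h_ae : {t : ℝ | t ∈ Icc (0 : ℝ) 1 ∧ f t ∈ Ioo a b} =ᵐ[volume]
      (Ioo 0 1 ∩ f ⁻¹' Ioo a b : Set ℝ) :=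
    Ioo_ae_eq_Icc.symm.inter (ae_eq_refl (f ⁻¹' Ioo a b))
  have h_eq : ∫ t in {t : ℝ | t ∈ Icc (0 : ℝ) 1 ∧ f t ∈ Ioo a b}, deriv f t = g 1 - g 0 := by
    rw [setIntegral_congr_set h_ae, ← hg_int, ← integral_indicator hS,
      ← integral_indicator measurableSet_Ioo, ← indicator_indicator]
    congr 1
    refine indicator_congr fun t ht ↦ ?_
    exact (deriv_max_min_const hab (hf_cont.continuousAt (isOpen_Ioo.mem_nhds ht))).symm
  have hg_mem (x : ℝ) : g x ∈ Icc a b :=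
    ⟨le_max_left _ _, max_le hab.le (min_le_left _ _)⟩
  rw [h_eq]
  exact ⟨sub_le_sub (hg_mem 1).1 (hg_mem 0).2, sub_le_sub (hg_mem 1).2 (hg_mem 0).1⟩

end
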